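/- The out-forest dimension of a digraph is at least the number of its weak components and at most the number of its strong components. -/

import Mathlib

open Finset

variable {n : ℕ}

/-- Kirchhoff (Laplacian) matrix of the weighted digraph whose arc `(j, i)`
has weight `a i j` (so `a i j` is the weight with which agent `i` accounts for `j`). -/
noncomputable def kirchhoff (a : Matrix (Fin n) (Fin n) ℝ) : Matrix (Fin n) (Fin n) ℝ :=
  Matrix.of fun i j => if i = j then ∑ k ∈ Finset.univ.erase i, a i k else -a i j

/-- `F` is a spanning diverging forest (out-forest) of the digraph with arcs
`u → v` present iff `a v u > 0`: every arc of `F` is an arc of the digraph,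
every vertex has in-degree at most one in `F`, and `F` has no directed cycles
(equivalently, no infinite directed walk). -/
def IsOutForest (a : Matrix (Fin n) (Fin n) ℝ) (F : Finset (Fin n × Fin n)) : Prop :=
  (∀ e ∈ F, 0 < a e.2 e.1) ∧
  (∀ u u' v : Fin n, (u, v) ∈ F → (u', v) ∈ F → u = u') ∧
  ¬ ∃ f : ℕ → Fin n, ∀ k, (f k, f (k + 1)) ∈ F

/-- Number of arcs of a maximum out-forest. -/
noncomputable def maxForestSize (a : Matrix (Fin n) (Fin n) ℝ) : ℕ :=
  sSup {k | ∃ F, IsOutForest a F ∧ F.card = k}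

/-- The out-forest dimension: the number of trees in any maximum out-forest. -/
noncomputable def outForestDim (a : Matrix (Fin n) (Fin n) ℝ) : ℕ :=
  n - maxForestSize a

open Classical in
/-- The set of maximum out-forests. -/
noncomputable def maxForests (a : Matrix (Fin n) (Fin n) ℝ) :
    Finset (Finset (Fin n × Fin n)) :=
  Finset.univ.filter fun F => IsOutForest a F ∧ F.card = maxForestSize a

/-- The weight of a forest: the product of its arc weights. -/
def forestWeight (a : Matrix (Fin n) (Fin n) ℝ) (F : Finset (Fin n × Fin n)) : ℝ :=
  ∏ e ∈ F, a e.2 e.1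

/-- In forest `F`, vertex `i` belongs to the tree diverging from (rooted at) `j`. -/
def InTreeRootedAt (F : Finset (Fin n × Fin n)) (j i : Fin n) : Prop :=
  (∀ u, (u, j) ∉ F) ∧ Relation.ReflTransGen (fun x y => (x, y) ∈ F) j i

open Classical in
/-- The normalized matrix of maximum out-forests. -/
noncomputable def barJ (a : Matrix (Fin n) (Fin n) ℝ) : Matrix (Fin n) (Fin n) ℝ :=
  Matrix.of fun i j =>
    (∑ F ∈ (maxForests a).filter (fun F => InTreeRootedAt F j i), forestWeight a F) /
    (∑ F ∈ maxForests a, forestWeight a F)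

/-- Reachability by directed paths (arc `u → v` present iff `a v u > 0`). -/
def Reach (a : Matrix (Fin n) (Fin n) ℝ) (u v : Fin n) : Prop :=
  Relation.ReflTransGen (fun x y => 0 < a y x) u v

/-- The strong component (bicomponent) of vertex `v`. -/
def strongClass (a : Matrix (Fin n) (Fin n) ℝ) (v : Fin n) : Set (Fin n) :=
  {u | Reach a u v ∧ Reach a v u}

/-- The set of strong components. -/
def strongClasses (a : Matrix (Fin n) (Fin n) ℝ) : Set (Set (Fin n)) :=
  {S | ∃ v, S = strongClass a v}

/-- Basis bicomponents: strong components with no arcs entering from outside. -/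
def basisClasses (a : Matrix (Fin n) (Fin n) ℝ) : Set (Set (Fin n)) :=
  {S | (∃ v, S = strongClass a v) ∧ ∀ u v, u ∉ S → v ∈ S → ¬ 0 < a v u}

/-- Weak reachability (underlying undirected graph). -/
def WeakReach (a : Matrix (Fin n) (Fin n) ℝ) (u v : Fin n) : Prop :=
  Relation.ReflTransGen (fun x y => 0 < a y x ∨ 0 < a x y) u v

/-- The set of weak components. -/
def weakClasses (a : Matrix (Fin n) (Fin n) ℝ) : Set (Set (Fin n)) :=
  {S | ∃ v, S = {u | WeakReach a u v}}

lemma forest_weak_bound {n : ℕ} (a : Matrix (Fin n) (Fin n) ℝ) (F : Finset (Fin n × Fin n))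
    (hF : IsOutForest a F) : F.card + (weakClasses a).ncard ≤ n := by
  classical
  obtain ⟨h1, h2, h3⟩ := hF
  have hwf : WellFounded (fun x y : Fin n => (x, y) ∈ F) := by
    have hs : WellFounded (fun x y : Fin n => (y, x) ∈ F) := by
      rw [wellFounded_iff_isEmpty_descending_chain]
      refine ⟨fun f => h3 ⟨f.1, f.2⟩⟩
    have hs2 := hs.transGen
    have hirr : ∀ x, ¬ Relation.TransGen (fun x y : Fin n => (x, y) ∈ F) x x := by
      intro x hx
      have hx' : Relation.TransGen (fun x y : Fin n => (y, x) ∈ F) x x := by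
        rw [← Relation.transGen_swap] at hx
        exact hx
      exact hs2.irrefl.irrefl x hx'
    haveI : Std.Irrefl (Relation.TransGen (fun x y : Fin n => (x, y) ∈ F)) := ⟨hirr⟩
    have hw := Finite.wellFounded_of_trans_of_irrefl
      (Relation.TransGen (fun x y : Fin n => (x, y) ∈ F))
    exact Subrelation.wf (fun h => Relation.TransGen.single h) hw
  have hroot : ∀ v, ∃ r, (∀ u, (u, r) ∉ F) ∧ WeakReach a r v := by
    intro v
    induction v using hwf.induction with
    | _ v ih =>
      by_cases hv : ∃ u, (u, v) ∈ F
      · obtain ⟨u, hu⟩ := hv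
        obtain ⟨r, hr, hru⟩ := ih u hu
        exact ⟨r, hr, Relation.ReflTransGen.tail hru (Or.inl (h1 _ hu))⟩
      · push Not at hv
        exact ⟨v, hv, Relation.ReflTransGen.refl⟩
  have hsymm : ∀ u v, WeakReach a u v → WeakReach a v u := by
    intro u v h
    unfold WeakReach at *
    induction h with
    | refl => exact Relation.ReflTransGen.refl
    | tail _ hbc ih => exact Relation.ReflTransGen.head hbc.symm ih
  have hcard : F.card = (F.image Prod.snd).card := by
    rw [Finset.card_image_of_injOn]
    rintro ⟨u, v⟩ hx ⟨u', v'⟩ hy hxy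
    simp only at hxy
    subst hxy
    rw [h2 u u' v hx hy]
  have hsub : weakClasses a ⊆
      (fun v => {u | WeakReach a u v}) '' (((F.image Prod.snd)ᶜ : Finset (Fin n)) : Set (Fin n)) := by
    rintro S ⟨v, rfl⟩
    obtain ⟨r, hr, hrv⟩ := hroot v
    refine ⟨r, ?_, ?_⟩
    · simp only [Finset.coe_compl, Set.mem_compl_iff, Finset.mem_coe, Finset.mem_image, not_exists,
        not_and]
      rintro ⟨u, w⟩ hu hw
      simp only at hw
      subst hw
      exact hr u hu
    · ext u
      exact ⟨fun h => Relation.ReflTransGen.trans h hrv,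
        fun h => Relation.ReflTransGen.trans h (hsymm _ _ hrv)⟩
  have h4 := Set.ncard_le_ncard hsub (Set.toFinite _)
  have h5 := Set.ncard_image_le (f := fun v => {u | WeakReach a u v})
    (s := (((F.image Prod.snd)ᶜ : Finset (Fin n)) : Set (Fin n))) (Set.toFinite _)
  rw [Set.ncard_coe_finset] at h5
  have h6 := Finset.card_add_card_compl (F.image Prod.snd)
  rw [Fintype.card_fin] at h6
  omega

/-- There is a directed walk of exactly `k` arcs from `r` to `v`. -/
def WalkLen {n : ℕ} (a : Matrix (Fin n) (Fin n) ℝ) (r : Fin n) : ℕ → Fin n → Prop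
  | 0, v => r = v
  | k + 1, v => ∃ u, WalkLen a r k u ∧ 0 < a v u

lemma reach_iff_walkLen {n : ℕ} (a : Matrix (Fin n) (Fin n) ℝ) (r v : Fin n) :
    Reach a r v ↔ ∃ k, WalkLen a r k v := by
  constructor
  · intro h
    unfold Reach at h
    induction h with
    | refl => exact ⟨0, rfl⟩
    | tail _ hbc ih =>
      obtain ⟨k, hk⟩ := ih
      exact ⟨k + 1, _, hk, hbc⟩
  · rintro ⟨k, hk⟩
    induction k generalizing v with
    | zero => cases hk; exact Relation.ReflTransGen.refl
    | succ k ih =>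
      obtain ⟨u, hu, huv⟩ := hk
      exact Relation.ReflTransGen.tail (ih u hu) huv

lemma exists_forest {n : ℕ} (a : Matrix (Fin n) (Fin n) ℝ) :
    ∃ F, IsOutForest a F ∧ n ≤ F.card + (strongClasses a).ncard := by
  classical
  have hne : ∀ S : strongClasses a, ∃ v, v ∈ S.1 := by
    rintro ⟨S, v, rfl⟩
    exact ⟨v, Relation.ReflTransGen.refl, Relation.ReflTransGen.refl⟩
  choose c hc using hne
  set rep : Fin n → Fin n := fun v => c ⟨strongClass a v, v, rfl⟩ with hrep
  have hrep1 : ∀ v, Reach a (rep v) v ∧ Reach a v (rep v) := fun v => hc ⟨strongClass a v, v, rfl⟩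
  have hrep2 : ∀ u v, strongClass a u = strongClass a v → rep u = rep v := by
    intro u v h
    simp only [hrep]
    congr 1
    exact Subtype.ext h
  have hex : ∀ v, ∃ k, WalkLen a (rep v) k v := fun v => (reach_iff_walkLen a _ _).1 (hrep1 v).1
  set d : Fin n → ℕ := fun v => Nat.find (hex v) with hd
  have hp : ∀ v, rep v ≠ v → ∃ u, 0 < a v u ∧ d u < d v := by
    intro v hv
    have hs : WalkLen a (rep v) (d v) v := Nat.find_spec (hex v)
    rcases hk : d v with _ | k
    · rw [hk] at hs
      exact absurd hs hv
    · rw [hk] at hs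
      obtain ⟨u, hu, huv⟩ := hs
      refine ⟨u, huv, ?_⟩
      have hru : Reach a (rep v) u := (reach_iff_walkLen a _ _).2 ⟨k, hu⟩
      have huv' : Reach a u v := Relation.ReflTransGen.single huv
      have hvu : Reach a v u := Relation.ReflTransGen.trans (hrep1 v).2 hru
      have hcl : rep u = rep v := by
        apply hrep2
        ext w
        exact ⟨fun h => ⟨h.1.trans huv', Relation.ReflTransGen.trans hvu h.2⟩,
          fun h => ⟨h.1.trans hvu, Relation.ReflTransGen.trans huv' h.2⟩⟩
      have : d u ≤ k := Nat.find_min' (hex u) (by rw [hcl]; exact hu)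
      omega
  choose! p hp1 hp2 using hp
  set N : Finset (Fin n) := Finset.univ.filter fun v => rep v ≠ v with hN
  refine ⟨N.image fun v => (p v, v), ⟨?_, ?_, ?_⟩, ?_⟩
  · intro e he
    obtain ⟨v, hv, rfl⟩ := Finset.mem_image.1 he
    exact hp1 v (Finset.mem_filter.1 hv).2
  · intro u u' v hu hu'
    obtain ⟨x, _, hx⟩ := Finset.mem_image.1 hu
    obtain ⟨y, _, hy⟩ := Finset.mem_image.1 hu'
    simp only [Prod.mk.injEq] at hx hy
    rw [← hx.1, ← hy.1, hx.2, hy.2]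
  · rintro ⟨f, hf⟩
    have hmono : StrictMono (d ∘ f) := by
      apply strictMono_nat_of_lt_succ
      intro k
      obtain ⟨x, hx, hxe⟩ := Finset.mem_image.1 (hf k)
      simp only [Prod.mk.injEq] at hxe
      have := hp2 x (Finset.mem_filter.1 hx).2
      rw [hxe.1, hxe.2] at this
      exact this
    exact not_injective_infinite_finite f (Function.Injective.of_comp hmono.injective)
  · rw [Finset.card_image_of_injective _ (fun x y h => (Prod.mk.inj h).2)]
    have h1 : N.card + Nᶜ.card = n := by
      rw [Finset.card_add_card_compl, Fintype.card_fin]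
    have h2 : Nᶜ.card ≤ (strongClasses a).ncard := by
      rw [← Set.ncard_coe_finset]
      refine Set.ncard_le_ncard_of_injOn (strongClass a) (fun v _ => ⟨v, rfl⟩) ?_ (Set.toFinite _)
      intro u hu v hv huv
      have hu' : rep u = u := by simpa [hN] using hu
      have hv' : rep v = v := by simpa [hN] using hv
      rw [← hu', ← hv']
      exact hrep2 u v huv
    omega

/-- The out-forest dimension of a digraph is at least the number of its weak
components and at most the number of its strong components. -/
theorem weak_le_outForestDim_le_strong {n : ℕ} (a : Matrix (Fin n) (Fin n) ℝ)
    (hnn : ∀ i j, 0 ≤ a i j) :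
    (weakClasses a).ncard ≤ outForestDim a ∧
      outForestDim a ≤ (strongClasses a).ncard := by
  have hb : BddAbove {k | ∃ F, IsOutForest a F ∧ F.card = k} := by
    refine ⟨n, ?_⟩
    rintro k ⟨F, hF, rfl⟩
    have := forest_weak_bound a F hF
    omega
  obtain ⟨G, hG, hGc⟩ := exists_forest a
  have hle : G.card ≤ maxForestSize a := le_csSup hb ⟨G, hG, rfl⟩
  obtain ⟨F, hF, hFc⟩ : ∃ F, IsOutForest a F ∧ F.card = maxForestSize a :=
    Nat.sSup_mem (s := {k | ∃ F, IsOutForest a F ∧ F.card = k}) ⟨_, G, hG, rfl⟩ hb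
  have := forest_weak_bound a F hF
  unfold outForestDim
  omega
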